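/- arXiv:2404.11283 — 6 statements merged into one kernel-verified Lean document; each statement's English description precedes it below -/
import Mathlib

section
/- Let X₁,…,Xₙ and Z be jointly distributed finite random variables such that for every index j, Xⱼ−Z−(Xᵢ)_{i≠j} is a Markov chain. Let T₁, T₂, T₃ be a partition of {1,…,n} and for each j ∈ {1,2,3} let Wⱼ = fⱼ((Xᵢ)_{i∈Tⱼ}, Z) be a deterministic function of the block (Xᵢ)_{i∈Tⱼ} and Z. Then, conditioned on any values (z, w₁, w₂, w₃) of (Z, W₁, W₂, W₃) with positive probability, the three blocks (Xᵢ)_{i∈T₁}, (Xᵢ)_{i∈T₂}, (Xᵢ)_{i∈T₃} are mutually independent. -/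
open Finset

/-- If each coordinate is conditionally independent of the remaining ones, then the mass at `x`
factors as the product of the one-dimensional marginals over `s` and the marginal off `s`. -/
lemma mul_total_pow_card_eq_prod_marginal_mul {ι : Type*} [Fintype ι] [DecidableEq ι]
    {X : ι → Type*} [∀ i, Fintype (X i)] [∀ i, DecidableEq (X i)]
    (p : (∀ i, X i) → ℝ) (m : ∀ i, X i → ℝ) (S : ℝ)
    (h : ∀ j x, p x * S = m j (x j) * ∑ v, p (Function.update x j v))
    (x : ∀ i, X i) (s : Finset ι) :
    p x * S ^ #s = (∏ i ∈ s, m i (x i)) * ∑ y with ∀ i, i ∉ s → y i = x i, p y := by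
  induction s using Finset.induction_on with
  | empty =>
    have : ({y | ∀ i, i ∉ (∅ : Finset ι) → y i = x i} : Finset (∀ i, X i)) = {x} := by
      ext y
      simp [funext_iff]
    rw [this]
    simp
  | insert j s hj ih =>
    have step : (∑ y with ∀ i, i ∉ s → y i = x i, p y) * S =
        m j (x j) * ∑ y with ∀ i, i ∉ insert j s → y i = x i, p y := by
      calc (∑ y with ∀ i, i ∉ s → y i = x i, p y) * S
          = ∑ y with ∀ i, i ∉ s → y i = x i,
              m j (x j) * ∑ v, p (Function.update y j v) := by
            rw [sum_mul]
            refine sum_congr rfl fun y hy => ?_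
            rw [h j y, (mem_filter.mp hy).2 j hj]
        _ = m j (x j) * ∑ y with ∀ i, i ∉ insert j s → y i = x i, p y := by
            rw [← mul_sum, ← sum_product']
            congr 1
            refine sum_bij' (fun a _ => Function.update a.1 j a.2)
              (fun y _ => (Function.update y j (x j), y j)) ?_ ?_ ?_ ?_ ?_
            · rintro ⟨y, v⟩ hy
              simp only [mem_product, mem_filter, mem_univ, true_and, and_true, mem_insert,
                not_or] at hy ⊢
              rintro i ⟨hij, his⟩
              rw [Function.update_of_ne hij, hy i his]
            · intro y hy
              simp only [mem_product, mem_filter, mem_univ, true_and, and_true, mem_insert,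
                not_or] at hy ⊢
              intro i his
              by_cases hij : i = j
              · subst hij
                simp
              · rw [Function.update_of_ne hij, hy i ⟨hij, his⟩]
            · rintro ⟨y, v⟩ hy
              simp only [mem_product, mem_filter, mem_univ, true_and, and_true] at hy
              simp [← hy j hj]
            · intro y _
              simp
            · intro a _
              rfl
    rw [card_insert_of_notMem hj, prod_insert hj, pow_succ, ← mul_assoc, ih, mul_assoc, step]
    ring

/-- A mass function on a finite product that factors over the coordinates is, after
normalization, the product of its normalized marginals. -/
lemma div_sum_eq_prod_marginal_div_sum {κ : Type*} [Fintype κ] [DecidableEq κ]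
    {Y : κ → Type*} [∀ k, Fintype (Y k)] [∀ k, DecidableEq (Y k)]
    (C : ℝ) (b : ∀ k, Y k → ℝ) (r : (∀ k, Y k) → ℝ) (hr : ∀ y, r y = C * ∏ k, b k (y k))
    (hR : ∑ y, r y ≠ 0) (y : ∀ k, Y k) :
    r y / ∑ y', r y' = ∏ j, (∑ y', if y' j = y j then r y' else 0) / ∑ y', r y' := by
  have total : ∀ c : ∀ k, Y k → ℝ, ∑ y' : ∀ k, Y k, ∏ k, c k (y' k) = ∏ k, ∑ v, c k v := by
    intro c
    rw [prod_univ_sum, Fintype.piFinset_univ]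
  have hRe : ∑ y', r y' = C * ∏ k, ∑ v, b k v := by
    simp_rw [hr]
    rw [← mul_sum, total]
  have hC : C ≠ 0 := left_ne_zero_of_mul (hRe ▸ hR)
  have hB : ∀ k, ∑ v, b k v ≠ 0 := fun k =>
    prod_ne_zero_iff.mp (right_ne_zero_of_mul (hRe ▸ hR)) k (mem_univ k)
  have marginal : ∀ j, (∑ y', if y' j = y j then r y' else 0) / ∑ y', r y' =
      b j (y j) / ∑ v, b j v := by
    intro j
    let c : ∀ k, Y k → ℝ := Function.update b j fun v => if v = y j then b j v else 0
    have hcj : ∑ v, c j v = b j (y j) := by simp [c]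
    have hck : ∀ k ∈ univ.erase j, c k = b k := fun k hk =>
      Function.update_of_ne (ne_of_mem_erase hk) _ _
    have hM : (∑ y', if y' j = y j then r y' else 0) = C * ∏ k, ∑ v, c k v := by
      rw [← total, mul_sum]
      refine sum_congr rfl fun y' _ => ?_
      rw [hr, ← mul_prod_erase univ (fun k => c k (y' k)) (mem_univ j),
        prod_congr rfl fun k hk => congrFun (hck k hk) (y' k),
        ← mul_prod_erase univ (fun k => b k (y' k)) (mem_univ j)]
      simp only [c, Function.update_self]
      split_ifs <;> simp
    rw [div_eq_div_iff hR (hB j), hM, hRe,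
      ← mul_prod_erase univ (fun k => ∑ v, c k v) (mem_univ j),
      ← mul_prod_erase univ (fun k => ∑ v, b k v) (mem_univ j), hcj,
      prod_congr rfl fun k hk => congrArg (fun g : Y k → ℝ => ∑ v, g v) (hck k hk)]
    ring
  rw [prod_congr rfl fun j _ => marginal j, prod_div_distrib, hr, hRe,
    mul_div_mul_left _ _ hC]

/-- A dependent function on `ι` is the same as its family of restrictions to the blocks of a
partition of `ι`. -/
def piEquivPiBlocks {ι κ : Type*} (X : ι → Type*) (T : κ → Finset ι) (t : ι → κ)
    (ht : ∀ i k, i ∈ T k ↔ t i = k) : (∀ i, X i) ≃ ∀ k, ∀ i : T k, X i where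
  toFun x _ i := x i
  invFun y i := y (t i) ⟨i, (ht i _).mpr rfl⟩
  left_inv _ := rfl
  right_inv y := by
    funext k ⟨i, hi⟩
    obtain rfl := (ht i k).mp hi
    rfl

/-- If a mass function on a finite product factors into functions of disjoint blocks of
coordinates, then, after normalization, it is the product of its normalized block marginals. -/
lemma div_sum_eq_prod_block_marginal_div_sum {ι κ : Type*} [Fintype ι] [DecidableEq ι]
    [Fintype κ] [DecidableEq κ] {X : ι → Type*} [∀ i, Fintype (X i)] [∀ i, DecidableEq (X i)]
    (T : κ → Finset ι) (t : ι → κ) (ht : ∀ i k, i ∈ T k ↔ t i = k)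
    (C : ℝ) (b : κ → (∀ i, X i) → ℝ) (hb : ∀ k x x', (∀ i ∈ T k, x i = x' i) → b k x = b k x')
    (r : (∀ i, X i) → ℝ) (hr : ∀ x, r x = C * ∏ k, b k x)
    (hR : ∑ x, r x ≠ 0) (x : ∀ i, X i) :
    r x / ∑ x', r x' =
      ∏ k, (∑ x', if ∀ i ∈ T k, x' i = x i then r x' else 0) / ∑ x', r x' := by
  let e := piEquivPiBlocks X T t ht
  have htotal : ∑ y, r (e.symm y) = ∑ x', r x' := e.symm.sum_comp r
  have key := div_sum_eq_prod_marginal_div_sum C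
    (fun k v => b k fun i => if hi : i ∈ T k then v ⟨i, hi⟩ else x i)
    (fun y => r (e.symm y)) (fun y => ?_) (htotal ▸ hR) (e x)
  · rw [htotal, e.symm_apply_apply] at key
    rw [key]
    refine prod_congr rfl fun k _ => ?_
    rw [← e.sum_comp]
    congr 1
    refine sum_congr rfl fun x' _ => ?_
    rw [e.symm_apply_apply]
    refine if_congr ?_ rfl rfl
    simp [e, piEquivPiBlocks, funext_iff]
  · rw [hr]
    congr 1
    refine prod_congr rfl fun k _ => hb k _ _ fun i hi => ?_
    obtain rfl := (ht i k).mp hi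
    simp [hi, e, piEquivPiBlocks]


/-- Let `X₁, …, Xₙ` and `Z` be jointly distributed finite random variables (joint
pmf `P`) such that for every `j`, `Xⱼ − Z − (Xᵢ)_{i≠j}` is a Markov chain.  Let
`T 0, T 1, T 2` be a partition of `{1,…,n}` and for each `j` let
`Wⱼ = f j ((Xᵢ)_{i ∈ T j}, Z)` be a deterministic function of the block
`(Xᵢ)_{i ∈ T j}` and `Z`.  Then, conditioned on any values `(z, w₀, w₁, w₂)` of
`(Z, W₀, W₁, W₂)` with positive probability, the three blocks
`(Xᵢ)_{i∈T 0}, (Xᵢ)_{i∈T 1}, (Xᵢ)_{i∈T 2}` are mutually independent. -/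
theorem block_cond_independence
    {n : ℕ} {X : Fin n → Type*} [∀ i, Fintype (X i)] [∀ i, DecidableEq (X i)]
    {Z : Type*} [Fintype Z]
    {W : Fin 3 → Type*} [∀ j, DecidableEq (W j)]
    (P : (∀ i, X i) → Z → ℝ)
    (hpos : ∀ x z, 0 ≤ P x z)
    (hsum : ∑ x, ∑ z, P x z = 1)
    (hMC : ∀ j : Fin n, ∀ x : ∀ i, X i, ∀ z : Z,
      P x z * (∑ x', P x' z) =
        (∑ x', if x' j = x j then P x' z else 0) *
          (∑ v : X j, P (Function.update x j v) z))
    (T : Fin 3 → Finset (Fin n))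
    (hdisj : ∀ j k, j ≠ k → Disjoint (T j) (T k))
    (hcover : T 0 ∪ T 1 ∪ T 2 = Finset.univ)
    (f : ∀ j : Fin 3, (∀ i, X i) → Z → W j)
    (hf : ∀ j : Fin 3, ∀ x x' z, (∀ i ∈ T j, x i = x' i) → f j x z = f j x' z)
    (z : Z) (w : ∀ j, W j)
    (hposCond : 0 < ∑ x', if (∀ j, f j x' z = w j) then P x' z else 0) :
    ∀ x : ∀ i, X i,
      (if (∀ j, f j x z = w j) then P x z else 0) /
          (∑ x', if (∀ j, f j x' z = w j) then P x' z else 0) =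
        ∏ j : Fin 3,
          (∑ x', if ((∀ i ∈ T j, x' i = x i) ∧ (∀ k, f k x' z = w k))
              then P x' z else 0) /
            (∑ x', if (∀ k, f k x' z = w k) then P x' z else 0) := by
  have hS : ∑ x', P x' z ≠ 0 := by
    refine (hposCond.trans_le (sum_le_sum fun x _ => ?_)).ne'
    split_ifs
    exacts [le_rfl, hpos x z]
  let m : ∀ i, X i → ℝ := fun i v => ∑ x', if x' i = v then P x' z else 0
  have hcover' : ∀ i, ∃ k, i ∈ T k := by
    intro i
    have hi : i ∈ T 0 ∪ T 1 ∪ T 2 := hcover ▸ mem_univ i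
    simp only [mem_union] at hi
    rcases hi with (hi | hi) | hi
    exacts [⟨0, hi⟩, ⟨1, hi⟩, ⟨2, hi⟩]
  choose t hmem using hcover'
  have ht : ∀ i k, i ∈ T k ↔ t i = k := by
    refine fun i k => ⟨fun hi => ?_, fun h => h ▸ hmem i⟩
    by_contra hne
    exact disjoint_left.mp (hdisj _ _ hne) (hmem i) hi
  have hfactor : ∀ x, P x z =
      (∑ x', P x' z) / (∑ x', P x' z) ^ n * ∏ k, ∏ i ∈ T k, m i (x i) := by
    intro x
    have h := mul_total_pow_card_eq_prod_marginal_mul (fun x => P x z) m _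
      (fun j x => hMC j x z) x univ
    have hblocks : ∏ k, ∏ i ∈ T k, m i (x i) = ∏ i, m i (x i) := by
      rw [← prod_fiberwise univ t]
      refine prod_congr rfl fun k _ => prod_congr ?_ fun _ _ => rfl
      ext i
      simp [ht]
    simp only [card_univ, Fintype.card_fin, mem_univ, not_true_eq_false, false_imp_iff,
      implies_true, filter_true] at h
    rw [hblocks, div_mul_eq_mul_div, eq_div_iff (pow_ne_zero n hS), h, mul_comm]
  intro x
  have key := div_sum_eq_prod_block_marginal_div_sum T t ht
    ((∑ x', P x' z) / (∑ x', P x' z) ^ n)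
    (fun k x => if f k x z = w k then ∏ i ∈ T k, m i (x i) else 0) ?_
    (fun x => if ∀ j, f j x z = w j then P x z else 0) ?_ hposCond.ne' x
  · rw [key]
    refine prod_congr rfl fun k _ => ?_
    simp only [ite_and]
    congr!
  · intro k x x' h
    simp only [hf k x x' z h]
    rw [prod_congr rfl fun i hi => by rw [h i hi]]
  · intro x
    split_ifs with h
    · simp only [h, if_true]
      exact hfactor x
    · push Not at h
      obtain ⟨j, hj⟩ := h
      rw [prod_eq_zero (mem_univ j) (if_neg hj), mul_zero]
end

section
/- Let (Y₁,B₁),…,(Yₙ,Bₙ) and Ã = (Ã₁,…,Ãₙ), X̃ = (X̃₁,…,X̃ₙ) be jointly distributed finite random variables such that for every index j: (i) (Yⱼ,Bⱼ)−(Ã,X̃)−((Yᵢ,Bᵢ)_{i≠j}) is a Markov chain, and (ii) (Yⱼ,Bⱼ)−(Ãⱼ,X̃ⱼ)−((Ãᵢ,X̃ᵢ)_{i≠j}) is a Markov chain. Then for all values (ã, x̃) with positive probability and all (b, y): Pr(b, y | ã, x̃) = ∏_{j=1}^{n} Pr(bⱼ, yⱼ | ãⱼ, x̃ⱼ). -/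
section Exchange

variable {ι : Type*} [Fintype ι] [DecidableEq ι] {Y B : ι → Type*}

/-- If replacing a single coordinate pair changes `Q` in proportion to the weights `m`, then so does
replacing all of them. -/
theorem mul_prod_eq_mul_prod_of_update (Q : (∀ i, Y i) → (∀ i, B i) → ℝ) (m : ∀ i, Y i → B i → ℝ)
    (h : ∀ j y b v u, Q y b * m j v u =
      Q (Function.update y j v) (Function.update b j u) * m j (y j) (b j))
    (y y' : ∀ i, Y i) (b b' : ∀ i, B i) :
    Q y b * ∏ j, m j (y' j) (b' j) = Q y' b' * ∏ j, m j (y j) (b j) := by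
  have key : ∀ s : Finset ι, Q y b * ∏ j ∈ s, m j (y' j) (b' j) =
      Q (s.piecewise y' y) (s.piecewise b' b) * ∏ j ∈ s, m j (y j) (b j) := by
    intro s
    induction s using Finset.induction_on with
    | empty => simp
    | insert j s hj ih =>
      have hs := h j (s.piecewise y' y) (s.piecewise b' b) (y' j) (b' j)
      rw [Finset.piecewise_eq_of_notMem _ _ _ hj, Finset.piecewise_eq_of_notMem _ _ _ hj] at hs
      rw [Finset.prod_insert hj, Finset.prod_insert hj, Finset.piecewise_insert,
        Finset.piecewise_insert]
      linear_combination m j (y' j) (b' j) * ih + (∏ j ∈ s, m j (y j) (b j)) * hs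
  simpa using key Finset.univ

variable [∀ i, Fintype (Y i)] [∀ i, Fintype (B i)]

theorem sum_sum_prod_eq_prod_sum_sum (m : ∀ i, Y i → B i → ℝ) :
    ∑ y : ∀ i, Y i, ∑ b : ∀ i, B i, ∏ j, m j (y j) (b j) = ∏ j, ∑ v, ∑ u, m j v u := by
  simp_rw [Finset.prod_univ_sum, Fintype.piFinset_univ]

variable [∀ i, DecidableEq (Y i)] [∀ i, DecidableEq (B i)]

/-- The mass of a coordinate pair, summed over all values of the pair, is the total mass. -/
theorem sum_sum_marginal (Q : (∀ i, Y i) → (∀ i, B i) → ℝ) (j : ι) :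
    (∑ v : Y j, ∑ u : B j, ∑ y, ∑ b, if y j = v ∧ b j = u then Q y b else 0) =
      ∑ y, ∑ b, Q y b := by
  have hcomm : (∑ p : Y j × B j, ∑ q : (∀ i, Y i) × (∀ i, B i),
      if (q.1 j, q.2 j) = p then Q q.1 q.2 else 0) = ∑ q : (∀ i, Y i) × (∀ i, B i), Q q.1 q.2 := by
    rw [Finset.sum_comm]
    simp
  simpa only [Fintype.sum_prod_type, Prod.mk.injEq] using hcomm

/-- If each coordinate pair is independent of the remaining ones under the finite mass function `Q`,
then the normalization of `Q` is the product of its marginals. -/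
theorem div_sum_eq_prod_marginal_div (Q : (∀ i, Y i) → (∀ i, B i) → ℝ)
    (hS : (∑ y, ∑ b, Q y b) ≠ 0)
    (h : ∀ j y b, Q y b * (∑ y', ∑ b', Q y' b') =
      (∑ y', ∑ b', if y' j = y j ∧ b' j = b j then Q y' b' else 0) *
        (∑ v : Y j, ∑ u : B j, Q (Function.update y j v) (Function.update b j u)))
    (y : ∀ i, Y i) (b : ∀ i, B i) :
    Q y b / (∑ y', ∑ b', Q y' b') =
      ∏ j, (∑ y', ∑ b', if y' j = y j ∧ b' j = b j then Q y' b' else 0) /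
        (∑ y', ∑ b', Q y' b') := by
  set S := ∑ y', ∑ b', Q y' b' with hSdef
  let m : ∀ i, Y i → B i → ℝ := fun j v u ↦
    ∑ y', ∑ b', if y' j = v ∧ b' j = u then Q y' b' else 0
  have hex := mul_prod_eq_mul_prod_of_update Q m (by
    intro j y b v u
    have h₁ := h j y b
    have h₂ := h j (Function.update y j v) (Function.update b j u)
    simp only [Function.update_self, Function.update_idem] at h₂
    refine mul_right_cancel₀ hS ?_
    linear_combination m j v u * h₁ - m j (y j) (b j) * h₂)
  have hsum : Q y b * ∏ _j : ι, S = S * ∏ j, m j (y j) (b j) := by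
    calc Q y b * ∏ _j : ι, S
        = Q y b * ∑ y' : ∀ i, Y i, ∑ b' : ∀ i, B i, ∏ j, m j (y' j) (b' j) := by
          rw [sum_sum_prod_eq_prod_sum_sum]
          exact congrArg _ (Finset.prod_congr rfl fun j _ ↦ (sum_sum_marginal Q j).symm)
      _ = S * ∏ j, m j (y j) (b j) := by
          simp_rw [Finset.mul_sum, hex y _ b, hSdef, Finset.sum_mul]
  rw [Finset.prod_div_distrib, div_eq_div_iff hS (Finset.prod_ne_zero_iff.2 fun _ _ ↦ hS), hsum,
    mul_comm]

end Exchange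

/-- Let `(Y₁,B₁), …, (Yₙ,Bₙ)` and `Ã = (Ã₁,…,Ãₙ)`, `X̃ = (X̃₁,…,X̃ₙ)` be jointly
distributed finite random variables (joint pmf `P`) such that for every index `j`:
(i) `(Yⱼ,Bⱼ) − (Ã,X̃) − ((Yᵢ,Bᵢ)_{i≠j})` is a Markov chain, and
(ii) `(Yⱼ,Bⱼ) − (Ãⱼ,X̃ⱼ) − ((Ãᵢ,X̃ᵢ)_{i≠j})` is a Markov chain.
Then for all values `(ã,x̃)` with positive probability and all `(b,y)`:
`Pr(b,y | ã,x̃) = ∏ⱼ Pr(bⱼ,yⱼ | ãⱼ,x̃ⱼ)`. -/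
theorem product_conditional
    {n : ℕ} {Y B A X : Fin n → Type*}
    [∀ i, Fintype (Y i)] [∀ i, Fintype (B i)] [∀ i, Fintype (A i)] [∀ i, Fintype (X i)]
    [∀ i, DecidableEq (Y i)] [∀ i, DecidableEq (B i)]
    [∀ i, DecidableEq (A i)] [∀ i, DecidableEq (X i)]
    (P : (∀ i, Y i) → (∀ i, B i) → (∀ i, A i) → (∀ i, X i) → ℝ)
    (hpos : ∀ y b a x, 0 ≤ P y b a x)
    (hsum : ∑ y, ∑ b, ∑ a, ∑ x, P y b a x = 1)
    (hMC1 : ∀ (j : Fin n) (y : ∀ i, Y i) (b : ∀ i, B i) (a : ∀ i, A i) (x : ∀ i, X i),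
      P y b a x * (∑ y', ∑ b', P y' b' a x) =
        (∑ y', ∑ b', if y' j = y j ∧ b' j = b j then P y' b' a x else 0) *
          (∑ v : Y j, ∑ u : B j,
            P (Function.update y j v) (Function.update b j u) a x))
    (hMC2 : ∀ (j : Fin n) (y : ∀ i, Y i) (b : ∀ i, B i) (a : ∀ i, A i) (x : ∀ i, X i),
      (∑ y', ∑ b', if y' j = y j ∧ b' j = b j then P y' b' a x else 0) *
          (∑ y', ∑ b', ∑ a', ∑ x',
            if a' j = a j ∧ x' j = x j then P y' b' a' x' else 0) =
        (∑ y', ∑ b', ∑ a', ∑ x',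
            if y' j = y j ∧ b' j = b j ∧ a' j = a j ∧ x' j = x j
              then P y' b' a' x' else 0) *
          (∑ y', ∑ b', P y' b' a x)) :
    ∀ (a : ∀ i, A i) (x : ∀ i, X i), 0 < (∑ y', ∑ b', P y' b' a x) →
      ∀ (y : ∀ i, Y i) (b : ∀ i, B i),
        P y b a x / (∑ y', ∑ b', P y' b' a x) =
          ∏ j : Fin n,
            (∑ y', ∑ b', ∑ a', ∑ x',
                if y' j = y j ∧ b' j = b j ∧ a' j = a j ∧ x' j = x j
                  then P y' b' a' x' else 0) /
              (∑ y', ∑ b', ∑ a', ∑ x',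
                if a' j = a j ∧ x' j = x j then P y' b' a' x' else 0) := by
  intro a x hS y b
  rw [div_sum_eq_prod_marginal_div (fun y b ↦ P y b a x) hS.ne'
    (fun j y b ↦ hMC1 j y b a x)]
  refine Finset.prod_congr rfl fun j _ ↦ ?_
  have hle : (∑ y', ∑ b', P y' b' a x) ≤ ∑ y', ∑ b', ∑ a', ∑ x',
      if a' j = a j ∧ x' j = x j then P y' b' a' x' else 0 := by
    refine Finset.sum_le_sum fun y' _ ↦ Finset.sum_le_sum fun b' _ ↦ ?_
    have hnonneg : ∀ a' x', 0 ≤ if a' j = a j ∧ x' j = x j then P y' b' a' x' else 0 :=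
      fun a' x' ↦ ite_nonneg (hpos ..) le_rfl
    calc P y' b' a x = if a j = a j ∧ x j = x j then P y' b' a x else 0 := by simp
      _ ≤ ∑ x', if a j = a j ∧ x' j = x j then P y' b' a x' else 0 :=
          Finset.single_le_sum (fun x' _ ↦ hnonneg a x') (Finset.mem_univ x)
      _ ≤ _ := Finset.single_le_sum
          (f := fun a' ↦ ∑ x', if a' j = a j ∧ x' j = x j then P y' b' a' x' else 0)
          (fun a' _ ↦ Finset.sum_nonneg fun x' _ ↦ hnonneg a' x') (Finset.mem_univ a)
  rw [div_eq_div_iff hS.ne' (hS.trans_le hle).ne']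
  exact hMC2 j y b a x
end

section
/- Let (Y₁,B₁),…,(Yₙ,Bₙ) and Ã = (Ã₁,…,Ãₙ), X̃ = (X̃₁,…,X̃ₙ) be jointly distributed finite random variables such that for every index j: (i) (Yⱼ,Bⱼ)−(Ã,X̃)−((Yᵢ,Bᵢ)_{i≠j}) is a Markov chain, and (ii) (Yⱼ,Bⱼ)−(Ãⱼ,X̃ⱼ)−((Ãᵢ,X̃ᵢ)_{i≠j}) is a Markov chain. Then for all values (ã, x̃, y) with positive probability (and with each Pr(yⱼ | ãⱼ, x̃ⱼ) > 0) and all b: Pr(b | ã, x̃, y) = ∏_{i=1}^{n} Pr(bᵢ | ãᵢ, x̃ᵢ, yᵢ). -/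
/-- A product of sums over the coordinates expands as a sum over pairs of tuples. -/
theorem Fintype.sum_sum_prod_eq {ι : Type*} [Fintype ι] [DecidableEq ι] {Y B : ι → Type*}
    [∀ i, Fintype (Y i)] [∀ i, Fintype (B i)] (m : ∀ i, Y i → B i → ℝ) :
    ∑ y : ∀ i, Y i, ∑ b : ∀ i, B i, ∏ i, m i (y i) (b i) = ∏ i, ∑ v, ∑ u, m i v u := by
  simp only [← Fintype.prod_sum]
  rw [← Fintype.prod_sum fun i v => ∑ u, m i v u]

/-- If every coordinate pair of a weight `F` splits off with factor `m i`, then changing the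
coordinates from `(y, b)` to `(y', b')` changes `F` by the corresponding factors. -/
theorem mul_prod_eq_mul_prod_of_split {ι : Type*} [Fintype ι] [DecidableEq ι] {Y B : ι → Type*}
    [∀ i, Fintype (Y i)] [∀ i, Fintype (B i)]
    (F : (∀ i, Y i) → (∀ i, B i) → ℝ) (m : ∀ i, Y i → B i → ℝ) {S : ℝ} (hS : S ≠ 0)
    (h : ∀ j y b, F y b * S = m j (y j) (b j) *
      ∑ v, ∑ u, F (Function.update y j v) (Function.update b j u))
    (y y' : ∀ i, Y i) (b b' : ∀ i, B i) :
    F y b * ∏ i, m i (y' i) (b' i) = F y' b' * ∏ i, m i (y i) (b i) := by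
  have exchange (j y b v u) : F y b * m j v u =
      F (Function.update y j v) (Function.update b j u) * m j (y j) (b j) := by
    have h₁ := h j y b
    have h₂ := h j (Function.update y j v) (Function.update b j u)
    simp only [Function.update_self, Function.update_idem] at h₂
    apply mul_right_cancel₀ hS
    linear_combination m j v u * h₁ - m j (y j) (b j) * h₂
  have piecewise (s : Finset ι) : F y b * ∏ i ∈ s, m i (y' i) (b' i) =
      F (s.piecewise y' y) (s.piecewise b' b) * ∏ i ∈ s, m i (y i) (b i) := by
    induction s using Finset.induction_on with
    | empty => simp
    | insert j s hj ih =>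
      have hx := exchange j (s.piecewise y' y) (s.piecewise b' b) (y' j) (b' j)
      rw [Finset.piecewise_eq_of_notMem _ _ _ hj, Finset.piecewise_eq_of_notMem _ _ _ hj] at hx
      rw [Finset.prod_insert hj, Finset.prod_insert hj, Finset.piecewise_insert,
        Finset.piecewise_insert]
      linear_combination m j (y' j) (b' j) * ih + (∏ i ∈ s, m i (y i) (b i)) * hx
  simpa using piecewise Finset.univ

/-- A weight from which every coordinate pair splits off is the product of its marginals. -/
theorem mul_pow_card_eq_prod_of_split {ι : Type*} [Fintype ι] [DecidableEq ι] {Y B : ι → Type*}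
    [∀ i, Fintype (Y i)] [∀ i, Fintype (B i)]
    (F : (∀ i, Y i) → (∀ i, B i) → ℝ) (m : ∀ i, Y i → B i → ℝ)
    (hS : ∑ y, ∑ b, F y b ≠ 0) (hm : ∀ j, ∑ v, ∑ u, m j v u = ∑ y, ∑ b, F y b)
    (h : ∀ j y b, F y b * ∑ y', ∑ b', F y' b' = m j (y j) (b j) *
      ∑ v, ∑ u, F (Function.update y j v) (Function.update b j u))
    (y : ∀ i, Y i) (b : ∀ i, B i) :
    F y b * (∑ y', ∑ b', F y' b') ^ Fintype.card ι =
      (∑ y', ∑ b', F y' b') * ∏ i, m i (y i) (b i) := by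
  calc F y b * (∑ y', ∑ b', F y' b') ^ Fintype.card ι
      = F y b * ∏ i, ∑ v, ∑ u, m i v u := by simp [hm]
    _ = ∑ y' : ∀ i, Y i, ∑ b' : ∀ i, B i, F y b * ∏ i, m i (y' i) (b' i) := by
        rw [← Fintype.sum_sum_prod_eq]; simp only [Finset.mul_sum]
    _ = _ := by
        simp only [Finset.sum_mul]
        exact Finset.sum_congr rfl fun y' _ => Finset.sum_congr rfl fun b' _ =>
          mul_prod_eq_mul_prod_of_split F m hS h y y' b b'

/-- Let `(Y₁,B₁), …, (Yₙ,Bₙ)` and `Ã = (Ã₁,…,Ãₙ)`, `X̃ = (X̃₁,…,X̃ₙ)` be jointly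
distributed finite random variables (joint pmf `P`) such that for every index `j`:
(i) `(Yⱼ,Bⱼ) − (Ã,X̃) − ((Yᵢ,Bᵢ)_{i≠j})` is a Markov chain, and
(ii) `(Yⱼ,Bⱼ) − (Ãⱼ,X̃ⱼ) − ((Ãᵢ,X̃ᵢ)_{i≠j})` is a Markov chain.
Then for all values `(ã,x̃,y)` with positive probability (and with each
`Pr(yⱼ | ãⱼ,x̃ⱼ) > 0`) and all `b`:
`Pr(b | ã,x̃,y) = ∏ᵢ Pr(bᵢ | ãᵢ,x̃ᵢ,yᵢ)`. -/
theorem product_conditional_b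
    {n : ℕ} {Y B A X : Fin n → Type*}
    [∀ i, Fintype (Y i)] [∀ i, Fintype (B i)] [∀ i, Fintype (A i)] [∀ i, Fintype (X i)]
    [∀ i, DecidableEq (Y i)] [∀ i, DecidableEq (B i)]
    [∀ i, DecidableEq (A i)] [∀ i, DecidableEq (X i)]
    (P : (∀ i, Y i) → (∀ i, B i) → (∀ i, A i) → (∀ i, X i) → ℝ)
    (hpos : ∀ y b a x, 0 ≤ P y b a x)
    (hsum : ∑ y, ∑ b, ∑ a, ∑ x, P y b a x = 1)
    (hMC1 : ∀ (j : Fin n) (y : ∀ i, Y i) (b : ∀ i, B i) (a : ∀ i, A i) (x : ∀ i, X i),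
      P y b a x * (∑ y', ∑ b', P y' b' a x) =
        (∑ y', ∑ b', if y' j = y j ∧ b' j = b j then P y' b' a x else 0) *
          (∑ v : Y j, ∑ u : B j,
            P (Function.update y j v) (Function.update b j u) a x))
    (hMC2 : ∀ (j : Fin n) (y : ∀ i, Y i) (b : ∀ i, B i) (a : ∀ i, A i) (x : ∀ i, X i),
      (∑ y', ∑ b', if y' j = y j ∧ b' j = b j then P y' b' a x else 0) *
          (∑ y', ∑ b', ∑ a', ∑ x',
            if a' j = a j ∧ x' j = x j then P y' b' a' x' else 0) =
        (∑ y', ∑ b', ∑ a', ∑ x',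
            if y' j = y j ∧ b' j = b j ∧ a' j = a j ∧ x' j = x j
              then P y' b' a' x' else 0) *
          (∑ y', ∑ b', P y' b' a x)) :
    ∀ (y : ∀ i, Y i) (a : ∀ i, A i) (x : ∀ i, X i),
      0 < (∑ b', P y b' a x) →
      (∀ j : Fin n, 0 < (∑ y', ∑ b', ∑ a', ∑ x',
          if y' j = y j ∧ a' j = a j ∧ x' j = x j then P y' b' a' x' else 0)) →
      ∀ b : ∀ i, B i,
        P y b a x / (∑ b', P y b' a x) =
          ∏ i : Fin n,
            (∑ y', ∑ b', ∑ a', ∑ x',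
                if y' i = y i ∧ b' i = b i ∧ a' i = a i ∧ x' i = x i
                  then P y' b' a' x' else 0) /
              (∑ y', ∑ b', ∑ a', ∑ x',
                if y' i = y i ∧ a' i = a i ∧ x' i = x i then P y' b' a' x' else 0) := by
  intro y a x hy hY b
  set S := ∑ y', ∑ b', P y' b' a x with hSdef
  have hS : 0 < S := hy.trans_le <|
    Finset.single_le_sum (f := fun y' => ∑ b', P y' b' a x)
      (fun y' _ => Finset.sum_nonneg fun b' _ => hpos y' b' a x) (Finset.mem_univ y)
  let m (j : Fin n) (v : Y j) (u : B j) : ℝ :=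
    ∑ y', ∑ b', if y' j = v ∧ b' j = u then P y' b' a x else 0
  let T (j : Fin n) : ℝ := ∑ y', ∑ b', ∑ a', ∑ x',
    if a' j = a j ∧ x' j = x j then P y' b' a' x' else 0
  let M (j : Fin n) (u : B j) : ℝ := ∑ y', ∑ b', ∑ a', ∑ x',
    if y' j = y j ∧ b' j = u ∧ a' j = a j ∧ x' j = x j then P y' b' a' x' else 0
  let N (j : Fin n) : ℝ := ∑ y', ∑ b', ∑ a', ∑ x',
    if y' j = y j ∧ a' j = a j ∧ x' j = x j then P y' b' a' x' else 0
  have hN (j) : 0 < N j := hY j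
  have hT (j) : 0 < T j := by
    refine (hN j).trans_le ?_
    refine Finset.sum_le_sum fun y' _ => Finset.sum_le_sum fun b' _ =>
      Finset.sum_le_sum fun a' _ => Finset.sum_le_sum fun x' _ => ?_
    have := hpos y' b' a' x'
    split_ifs <;> tauto
  have hMN (j) : ∑ u, M j u = N j := by
    simp only [M, N]
    rw [Finset.sum_comm]
    refine Finset.sum_congr rfl fun y' _ => ?_
    rw [Finset.sum_comm]
    refine Finset.sum_congr rfl fun b' _ => ?_
    rw [Finset.sum_comm]
    refine Finset.sum_congr rfl fun a' _ => ?_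
    rw [Finset.sum_comm]
    refine Finset.sum_congr rfl fun x' _ => ?_
    simp [ite_and]
  have hm (j) : ∑ v, ∑ u, m j v u = S := by
    have hu (v : Y j) : ∑ u, m j v u = ∑ y', ∑ b', if y' j = v then P y' b' a x else 0 := by
      simp only [m]
      rw [Finset.sum_comm]
      refine Finset.sum_congr rfl fun y' _ => ?_
      rw [Finset.sum_comm]
      simp [ite_and]
    simp only [hu, hSdef]
    rw [Finset.sum_comm]
    refine Finset.sum_congr rfl fun y' _ => ?_
    rw [Finset.sum_comm]
    simp
  have hmM (j) (u : B j) : m j (y j) u * T j = M j u * S := by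
    simpa using hMC2 j y (Function.update b j u) a x
  have hmN (j) : (∑ u, m j (y j) u) * T j = N j * S := by
    rw [← hMN, Finset.sum_mul, Finset.sum_mul]
    exact Finset.sum_congr rfl fun u _ => hmM j u
  have hprod (b : ∀ i, B i) : P y b a x * S ^ n = S * ∏ i, m i (y i) (b i) := by
    simpa using mul_pow_card_eq_prod_of_split (fun y b => P y b a x) m hS.ne' hm
      (fun j y b => hMC1 j y b a x) y b
  have hprod_sum : (∑ b', P y b' a x) * S ^ n = S * ∏ i, ∑ u, m i (y i) u := by
    rw [Finset.sum_mul, Finset.sum_congr rfl fun b' _ => hprod b', ← Finset.mul_sum,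
      Fintype.prod_sum]
  calc P y b a x / ∑ b', P y b' a x
      = (P y b a x * S ^ n) / ((∑ b', P y b' a x) * S ^ n) :=
        (mul_div_mul_right _ _ (pow_ne_zero n hS.ne')).symm
    _ = ∏ i, m i (y i) (b i) / ∑ u, m i (y i) u := by
        rw [hprod, hprod_sum, mul_div_mul_left _ _ hS.ne', Finset.prod_div_distrib]
    _ = ∏ i, M i (b i) / N i := by
        refine Finset.prod_congr rfl fun i _ => ?_
        rw [← mul_div_mul_right _ _ (hT i).ne', hmM, hmN, mul_div_mul_right _ _ hS.ne']
end

section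
/- Let P and Q be probability mass functions on a product A×B of finite types, let c > 0, and let a ∈ A satisfy Q^A(a) ≥ c and P^A(a) > 0, where P^A, Q^A denote the marginals on A. Then the conditional distributions on B given a satisfy ∑_{b} |P(b|a) − Q(b|a)| ≤ (2/c) · ∑_{a',b} |P(a',b) − Q(a',b)|. -/
/-- Normalizing two weight functions `p ≥ 0` and `q` of positive total mass increases their
one-norm distance by at most a factor of `2 / ∑ q`. -/
theorem sum_abs_normalize_sub_le {B : Type*} [Fintype B] (p q : B → ℝ) (hp : ∀ b, 0 ≤ p b)
    (hpsum : 0 < ∑ b, p b) (hqsum : 0 < ∑ b, q b) :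
    ∑ b, |p b / (∑ b', p b') - q b / (∑ b', q b')| ≤ 2 / (∑ b, q b) * ∑ b, |p b - q b| := by
  have hdiff : |∑ b, q b - ∑ b, p b| ≤ ∑ b, |p b - q b| := by
    rw [abs_sub_comm, ← Finset.sum_sub_distrib]
    exact Finset.abs_sum_le_sum_abs _ _
  set S := ∑ b, p b with hS
  set T := ∑ b, q b
  have hterm (b : B) : |p b / S - q b / T| ≤ p b * (|T - S| / (S * T)) + |p b - q b| / T := by
    have hsplit : p b / S - q b / T = p b * ((T - S) / (S * T)) + (p b - q b) / T := by
      field_simp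
      ring
    rw [hsplit]
    refine (abs_add_le _ _).trans_eq ?_
    rw [abs_mul, abs_div, abs_div, abs_of_nonneg (hp b), abs_of_pos hqsum,
      abs_of_pos (mul_pos hpsum hqsum)]
  calc ∑ b, |p b / S - q b / T|
      ≤ ∑ b, (p b * (|T - S| / (S * T)) + |p b - q b| / T) :=
        Finset.sum_le_sum fun b _ => hterm b
    _ = |T - S| / T + (∑ b, |p b - q b|) / T := by
        rw [Finset.sum_add_distrib, ← Finset.sum_mul, ← Finset.sum_div, ← hS]
        field_simp
    _ ≤ (∑ b, |p b - q b|) / T + (∑ b, |p b - q b|) / T := by gcongr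
    _ = 2 / T * ∑ b, |p b - q b| := by ring

/-- Let `P` and `Q` be probability mass functions on `A × B` (finite types),
`c > 0`, and `a ∈ A` with `Q^A(a) ≥ c` and `P^A(a) > 0`.  Then the conditional
distributions on `B` given `a` satisfy
`∑_b |P(b|a) − Q(b|a)| ≤ (2/c) · ∑_{a',b} |P(a',b) − Q(a',b)|`. -/
theorem conditional_one_norm_bound
    {A B : Type*} [Fintype A] [Fintype B]
    (P Q : A → B → ℝ)
    (hP : ∀ a b, 0 ≤ P a b) (hQ : ∀ a b, 0 ≤ Q a b)
    (hPsum : ∑ a, ∑ b, P a b = 1) (hQsum : ∑ a, ∑ b, Q a b = 1)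
    (c : ℝ) (hc : 0 < c) (a : A)
    (hQa : c ≤ ∑ b, Q a b) (hPa : 0 < ∑ b, P a b) :
    ∑ b, |P a b / (∑ b', P a b') - Q a b / (∑ b', Q a b')| ≤
      (2 / c) * ∑ a', ∑ b, |P a' b - Q a' b| := by
  refine (sum_abs_normalize_sub_le (P a) (Q a) (hP a) hPa (hc.trans_le hQa)).trans ?_
  have hrow : ∑ b, |P a b - Q a b| ≤ ∑ a', ∑ b, |P a' b - Q a' b| :=
    Finset.single_le_sum (f := fun a' => ∑ b, |P a' b - Q a' b|)
      (fun _ _ => Finset.sum_nonneg fun _ _ => abs_nonneg _) (Finset.mem_univ a)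
  gcongr
end

section
/- Let A₀ = {a ∈ (ZMod 2)³ : a₀+a₁+a₂ = 0} and B₁ = {b ∈ (ZMod 2)³ : b₀+b₁+b₂ = 1}. Consider the joint distribution in which x, y are drawn uniformly and independently from Fin 3 and then (a,b) is drawn uniformly from S_{xy} = {(a,b) ∈ A₀×B₁ : a_y = b_x}. Then for every y ∈ Fin 3, every b ∈ B₁ with b ≠ (1,1,1), and every a ∈ A₀: Pr(a | b, y) = 1/6 if a_y = 1 and Pr(a | b, y) = 2/6 if a_y = 0. In particular 1/6 ≤ Pr(a | b, y) ≤ 2/6 for all such a, b, y. -/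
/-- Even-parity output triples for Alice in the Magic Square game. -/
abbrev MSA : Type := {a : Fin 3 → ZMod 2 // a 0 + a 1 + a 2 = 0}

/-- Odd-parity output triples for Bob in the Magic Square game. -/
abbrev MSB : Type := {b : Fin 3 → ZMod 2 // b 0 + b 1 + b 2 = 1}

/-- The joint distribution of `(x, y, a, b)` in which `x, y` are drawn uniformly
and independently from `Fin 3` and then `(a, b)` is drawn uniformly from
`S_{xy} = {(a,b) ∈ A₀×B₁ : a_y = b_x}` (each of the `8` winning pairs gets mass
`1/8`). -/
noncomputable def MSjoint (x y : Fin 3) (a : MSA) (b : MSB) : ℝ :=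
  (1 / 9) * (if a.val y = b.val x then (1 / 8 : ℝ) else 0)

/-- Summing out `x` leaves `1/72` times the number of coordinates of `b` equal to `a_y`. -/
theorem sum_MSjoint_eq_card (y : Fin 3) (a : MSA) (b : MSB) :
    ∑ x : Fin 3, MSjoint x y a b =
      (1 / 72 : ℝ) * (Finset.univ.filter fun x : Fin 3 => a.val y = b.val x).card := by
  simp only [MSjoint, ← Finset.mul_sum, Finset.sum_ite, Finset.sum_const, nsmul_eq_mul]
  ring

/-- An odd-parity triple other than `(1,1,1)` has exactly one `1` and two `0`s. -/
theorem card_filter_eq_of_ne_one :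
    ∀ b : MSB, b.val ≠ ![1, 1, 1] → ∀ c : ZMod 2,
      (Finset.univ.filter fun x : Fin 3 => c = b.val x).card = if c = 1 then 1 else 2 := by
  decide

/-- Each coordinate takes each value on exactly two of the four even-parity triples. -/
theorem sum_MSA_ite_eq_six :
    ∀ y : Fin 3, (∑ a : MSA, if a.val y = 1 then 1 else 2) = 6 := by
  decide

/-- For every `y ∈ Fin 3`, every `b ∈ B₁` with `b ≠ (1,1,1)`, and every
`a ∈ A₀`: `Pr(a | b, y) = 1/6` if `a_y = 1` and `Pr(a | b, y) = 2/6` if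
`a_y = 0`; in particular `1/6 ≤ Pr(a | b, y) ≤ 2/6`. -/
theorem magic_square_cond_a_given_b_y
    (y : Fin 3) (b : MSB) (hb : b.val ≠ ![1, 1, 1]) (a : MSA) :
    ((∑ x : Fin 3, MSjoint x y a b) /
        (∑ a' : MSA, ∑ x : Fin 3, MSjoint x y a' b) =
      if a.val y = 1 then (1 / 6 : ℝ) else 2 / 6) ∧
    (1 / 6 : ℝ) ≤
      (∑ x : Fin 3, MSjoint x y a b) /
        (∑ a' : MSA, ∑ x : Fin 3, MSjoint x y a' b) ∧
    (∑ x : Fin 3, MSjoint x y a b) /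
        (∑ a' : MSA, ∑ x : Fin 3, MSjoint x y a' b) ≤ 2 / 6 := by
  have hnum (a : MSA) : ∑ x : Fin 3, MSjoint x y a b =
      (1 / 72 : ℝ) * ((if a.val y = 1 then 1 else 2 : ℕ) : ℝ) := by
    rw [sum_MSjoint_eq_card, card_filter_eq_of_ne_one b hb]
  have hden : ∑ a' : MSA, ∑ x : Fin 3, MSjoint x y a' b = 1 / 12 := by
    simp only [hnum]
    rw [← Finset.mul_sum, ← Nat.cast_sum, sum_MSA_ite_eq_six]
    norm_num
  rw [hden, hnum]
  split_ifs <;> norm_num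
end

section
/- Let P be a probability mass function on D×E×W×C where D, E, W are finite types and C = {0,1}. Suppose (i) ∑_{d,e,w,c} |P(d,e,w,c) − P(d,e,w)·(1/2)| ≤ δ (i.e., the C-coordinate is δ-close in one-norm to an independent uniform bit), and (ii) D−E−W is a Markov chain. Define Q(d,e,w,c) = P(d,e) · P(w,c | e) (set to 0 when P(e) = 0). Then ∑_{d,e,w,c} |P(d,e,w,c) − Q(d,e,w,c)| ≤ 2δ. -/
/-- If `h` is proportional to the nonnegative weight `a`, then replacing `f` by the multiple of `a`
with the same total mass costs at most twice the one-norm distance from `f` to `h`. -/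
theorem sum_abs_sub_mul_sum_div_le {ι : Type*} [Fintype ι] (f h a : ι → ℝ)
    (ha : ∀ i, 0 ≤ a i) (h_zero : ∀ i, a i = 0 → h i = 0)
    (h_prop : ∀ i, h i * ∑ j, a j = a i * ∑ j, h j) :
    ∑ i, |f i - a i * ((∑ j, f j) / ∑ j, a j)| ≤ 2 * ∑ i, |f i - h i| := by
  have h_eq (i : ι) : h i = a i / (∑ j, a j) * ∑ j, h j := by
    by_cases hp : ∑ j, a j = 0
    · have hai : a i = 0 :=
        (Finset.sum_eq_zero_iff_of_nonneg fun j _ => ha j).1 hp i (Finset.mem_univ i)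
      simp [hai, h_zero i hai]
    · rw [div_mul_eq_mul_div, ← h_prop i, mul_div_cancel_right₀ _ hp]
  have h_nonneg (i : ι) : 0 ≤ a i / ∑ j, a j :=
    div_nonneg (ha i) (Finset.sum_nonneg fun j _ => ha j)
  have h_pointwise (i : ι) : |f i - a i * ((∑ j, f j) / ∑ j, a j)| ≤
      |f i - h i| + a i / (∑ j, a j) * ∑ j, |f j - h j| := by
    have h_split : f i - a i * ((∑ j, f j) / ∑ j, a j) =
        (f i - h i) - a i / (∑ j, a j) * ∑ j, (f j - h j) := by
      rw [Finset.sum_sub_distrib, mul_sub, ← h_eq i]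
      ring
    rw [h_split]
    refine (abs_sub _ _).trans ?_
    rw [abs_mul, abs_of_nonneg (h_nonneg i)]
    gcongr
    · exact h_nonneg i
    · exact Finset.abs_sum_le_sum_abs _ _
  calc
    _ ≤ ∑ i, (|f i - h i| + a i / (∑ j, a j) * ∑ j, |f j - h j|) :=
      Finset.sum_le_sum fun i _ => h_pointwise i
    _ = ∑ i, |f i - h i| + (∑ j, a j) / (∑ j, a j) * ∑ j, |f j - h j| := by
      rw [Finset.sum_add_distrib, ← Finset.sum_mul, ← Finset.sum_div]
    _ ≤ ∑ i, |f i - h i| + 1 * ∑ j, |f j - h j| := by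
      gcongr
      exact div_self_le_one _
    _ = 2 * ∑ i, |f i - h i| := by ring

theorem sum_comm_last {D E W C : Type*} [Fintype D] [Fintype E] [Fintype W] [Fintype C]
    (F : D → E → W → C → ℝ) :
    ∑ d, ∑ e, ∑ w, ∑ c, F d e w c = ∑ e, ∑ w, ∑ c, ∑ d, F d e w c := by
  rw [Finset.sum_comm]
  refine Finset.sum_congr rfl fun e _ => ?_
  rw [Finset.sum_comm]
  exact Finset.sum_congr rfl fun w _ => Finset.sum_comm

/-- Let `P` be a probability mass function on `D × E × W × C` with `C = {0,1}`.
If (i) the `C`-coordinate is `δ`-close in one-norm to an independent uniform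
bit, i.e. `∑_{d,e,w,c} |P(d,e,w,c) − P(d,e,w)·(1/2)| ≤ δ`, and (ii) `D − E − W`
is a Markov chain, then `P` is `2δ`-close in one-norm to
`Q(d,e,w,c) = P(d,e) · P(w,c | e)` (where the conditional is `0` when
`P(e) = 0`, as encoded by division). -/
theorem close_to_markov_product
    {D E W : Type*} [Fintype D] [Fintype E] [Fintype W]
    (P : D → E → W → Bool → ℝ)
    (hpos : ∀ d e w c, 0 ≤ P d e w c)
    (hsum : ∑ d, ∑ e, ∑ w, ∑ c, P d e w c = 1)
    (δ : ℝ)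
    (hclose : ∑ d, ∑ e, ∑ w, ∑ c,
      |P d e w c - (∑ c', P d e w c') * (1 / 2)| ≤ δ)
    (hMC : ∀ d e w,
      (∑ c, P d e w c) * (∑ d', ∑ w', ∑ c, P d' e w' c) =
        (∑ w', ∑ c, P d e w' c) * (∑ d', ∑ c, P d' e w c)) :
    ∑ d, ∑ e, ∑ w, ∑ c,
      |P d e w c -
        (∑ w', ∑ c', P d e w' c') *
          ((∑ d', P d' e w c) / (∑ d', ∑ w', ∑ c', P d' e w' c'))| ≤ 2 * δ := by
  have h_marginal_nonneg (d : D) (e : E) (w : W) : 0 ≤ ∑ c, P d e w c :=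
    Finset.sum_nonneg fun c _ => hpos d e w c
  refine le_trans ?_ (mul_le_mul_of_nonneg_left hclose zero_le_two)
  rw [sum_comm_last, sum_comm_last fun d e w c => |P d e w c - (∑ c', P d e w c') * (1 / 2)|]
  simp only [Finset.mul_sum (a := (2 : ℝ))]
  refine Finset.sum_le_sum fun e _ => Finset.sum_le_sum fun w _ => Finset.sum_le_sum fun c _ => ?_
  rw [← Finset.mul_sum]
  refine sum_abs_sub_mul_sum_div_le (fun d => P d e w c) (fun d => (∑ c', P d e w c') * (1 / 2))
    (fun d => ∑ w', ∑ c', P d e w' c')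
    (fun d => Finset.sum_nonneg fun w' _ => h_marginal_nonneg d e w') (fun d hd => ?_) fun d => ?_
  · have h_zero := (Finset.sum_eq_zero_iff_of_nonneg
      fun w' _ => h_marginal_nonneg d e w').1 hd w (Finset.mem_univ w)
    simp only [h_zero, zero_mul]
  · rw [← Finset.sum_mul]
    linear_combination (1 / 2) * hMC d e w
end
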